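/- arXiv:0709.4077 — 6 statements merged into one kernel-verified Lean document; each statement's English description precedes it below -/
import Mathlib

section
/- Let φ : ℝ^m → ℝ^m be a C¹ diffeomorphism (a C¹ bijection with C¹ inverse) and let p be a fixed point of φ that is isolated in the fixed-point set of φ. Let k ≥ 1 be an admissible iteration at p, i.e., for every complex root λ of the characteristic polynomial of the derivative Dφ_p with λ ≠ 1 one has λ^k ≠ 1. Then p is isolated in the fixed-point set of the k-fold iterate φ^k. -/
open Filter Topology

open Polynomial in
/-- If no complex root `μ ≠ 1` of the characteristic polynomial of `f` satisfies `μ ^ k = 1`,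
then the geometric sum `1 + f + ⋯ + f ^ (k - 1)` is invertible. -/
theorem LinearMap.isUnit_geom_sum_of_charpoly_roots {V : Type*} [AddCommGroup V] [Module ℝ V]
    [FiniteDimensional ℝ V] (f : V →ₗ[ℝ] V) {k : ℕ} (hk : 1 ≤ k)
    (hf : ∀ μ : ℂ, μ ≠ 1 → (f.charpoly.map (algebraMap ℝ ℂ)).IsRoot μ → μ ^ k ≠ 1) :
    IsUnit (∑ i ∈ Finset.range k, f ^ i) := by
  have hcop : IsCoprime f.charpoly (∑ i ∈ Finset.range k, (X : ℝ[X]) ^ i) := by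
    rw [isCoprime_iff_aeval_ne_zero_of_isAlgClosed ℝ ℂ]
    intro μ
    by_contra! h
    obtain ⟨hroot, hsum⟩ := h
    simp only [map_sum, map_pow, aeval_X] at hsum
    rcases eq_or_ne μ 1 with rfl | hμ
    · simp at hsum
      omega
    · refine hf μ hμ (by rwa [IsRoot, eval_map_algebraMap]) ?_
      rw [← sub_eq_zero, ← geom_sum_mul, hsum, zero_mul]
  obtain ⟨a, b, hab⟩ := hcop
  have h := congrArg (aeval f) hab
  simp only [map_add, map_mul, f.aeval_self_charpoly, mul_zero, zero_add, map_sum, map_pow,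
    aeval_X, map_one] at h
  exact IsUnit.of_mul_eq_one_right _ h

/-- A map whose strict derivative at `p` is an equivalence separates `z` from `g z` for `z` near
`p`, whenever `g` is continuous at its fixed point `p` and `g z ≠ z`. -/
theorem HasStrictFDerivAt.eventually_eq_of_map_eq {E F : Type*} [NormedAddCommGroup E]
    [NormedSpace ℝ E] [CompleteSpace E] [NormedAddCommGroup F] [NormedSpace ℝ F]
    {G : E → F} {G' : E ≃L[ℝ] F} {g : E → E} {p : E}
    (hG : HasStrictFDerivAt G (G' : E →L[ℝ] F) p) (hg : ContinuousAt g p) (hp : g p = p) :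
    ∀ᶠ z in 𝓝 p, G (g z) = G z → g z = z := by
  have hleft := hG.eventually_left_inverse
  have hg' : Tendsto g (𝓝 p) (𝓝 p) := by simpa only [ContinuousAt, hp] using hg
  filter_upwards [hleft, hg'.eventually hleft] with z hz hgz h
  rw [← hgz, h, hz]


/-- Proposition 1.3: an isolated fixed point of a C¹ diffeomorphism of ℝ^m
remains isolated under any admissible iteration. -/
theorem isolated_fixed_point_persists_under_admissible_iteration
    (m k : ℕ) (hk : 1 ≤ k)
    (φ ψ : EuclideanSpace ℝ (Fin m) → EuclideanSpace ℝ (Fin m))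
    (hφ : ContDiff ℝ 1 φ) (hψ : ContDiff ℝ 1 ψ)
    (hli : Function.LeftInverse ψ φ) (hri : Function.RightInverse ψ φ)
    (p : EuclideanSpace ℝ (Fin m)) (hp : φ p = p)
    (hiso : ∃ U ∈ nhds p, ∀ z ∈ U, φ z = z → z = p)
    (hadm : ∀ μ : ℂ, μ ≠ 1 →
      (((fderiv ℝ φ p : EuclideanSpace ℝ (Fin m) →ₗ[ℝ] EuclideanSpace ℝ (Fin m)).charpoly.map
        (algebraMap ℝ ℂ)).IsRoot μ) → μ ^ k ≠ 1) :
    ∃ U ∈ nhds p, ∀ z ∈ U, φ^[k] z = z → z = p := by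
  have hd : HasStrictFDerivAt φ (fderiv ℝ φ p) p :=
    hφ.contDiffAt.hasStrictFDerivAt one_ne_zero
  set A := fderiv ℝ φ p
  have hG : HasStrictFDerivAt (fun z => ∑ i ∈ Finset.range k, φ^[i] z)
      (∑ i ∈ Finset.range k, A ^ i) p :=
    .fun_sum fun i _ => hd.iterate hp i
  have hunit :=
    (A : EuclideanSpace ℝ (Fin m) →ₗ[ℝ] EuclideanSpace ℝ (Fin m)).isUnit_geom_sum_of_charpoly_roots hk hadm
  have hbij : Function.Bijective ⇑(∑ i ∈ Finset.range k, A ^ i) := by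
    have h := (Module.End.isUnit_iff _).mp hunit
    convert! h using 1
    ext1 v
    simp [← ContinuousLinearMap.toLinearMap_pow]
  let G' := ContinuousLinearEquiv.ofBijective (∑ i ∈ Finset.range k, A ^ i)
    (LinearMap.ker_eq_bot.mpr hbij.1) (LinearMap.range_eq_top.mpr hbij.2)
  have hG' : HasStrictFDerivAt (fun z => ∑ i ∈ Finset.range k, φ^[i] z)
      (G' : EuclideanSpace ℝ (Fin m) →L[ℝ] EuclideanSpace ℝ (Fin m)) p := by
    rwa [ContinuousLinearEquiv.coe_ofBijective]
  obtain ⟨U, hU, hUp⟩ := hiso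
  refine ⟨_, inter_mem hU (hG'.eventually_eq_of_map_eq hφ.continuous.continuousAt hp), ?_⟩
  rintro z ⟨hzU, hz⟩ hkz
  refine hUp z hzU (hz ?_)
  rw [← sub_eq_zero, ← Finset.sum_sub_distrib]
  simp only [← Function.iterate_succ_apply]
  rw [Finset.sum_range_sub (fun i => φ^[i] z), hkz, Function.iterate_zero_apply, sub_self]
end

section
/- Let φ : [0,1] × ℝ^m → ℝ^m be such that each map φ_s := φ(s,·) is a C¹ diffeomorphism of ℝ^m fixing a point p, and such that (s,z) ↦ φ_s(z) and (s,z) ↦ D_z φ_s(z) are jointly continuous. Let k ≥ 1 be admissible at p for every φ_s, i.e., for every s ∈ [0,1] and every complex root λ ≠ 1 of the characteristic polynomial of D(φ_s)_p one has λ^k ≠ 1. Then there exists a neighborhood U of p, depending on k but not on s, such that for every s ∈ [0,1], every point z ∈ U with φ_s^k(z) = z satisfies φ_s(z) = z. -/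
open Polynomial in
/-- If no eigenvalue of `A` other than `1` is a `k`-th root of unity, then `1 + A + ⋯ + A ^ (k - 1)`
is injective. -/
theorem LinearMap.ker_geom_sum_eq_bot {E : Type*} [AddCommGroup E] [Module ℝ E]
    [FiniteDimensional ℝ E] (A : E →ₗ[ℝ] E) {k : ℕ} (hk : k ≠ 0)
    (h : ∀ μ : ℂ, μ ≠ 1 → (A.charpoly.map (algebraMap ℝ ℂ)).IsRoot μ → μ ^ k ≠ 1) :
    LinearMap.ker (∑ i ∈ Finset.range k, A ^ i) = ⊥ := by
  have hco : IsCoprime A.charpoly (∑ i ∈ Finset.range k, (X : ℝ[X]) ^ i) := by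
    rw [isCoprime_iff_aeval_ne_zero_of_isAlgClosed ℝ ℂ]
    intro μ
    by_contra! hμ
    obtain ⟨hchar, hsum⟩ := hμ
    simp only [map_sum, map_pow, aeval_X] at hsum
    by_cases h1 : μ = 1
    · simp [h1, hk] at hsum
    · refine h μ h1 ?_ ?_
      · rwa [IsRoot.def, eval_map_algebraMap]
      · have := geom_sum_mul μ k
        rw [hsum, zero_mul] at this
        exact sub_eq_zero.mp this.symm
  simpa [LinearMap.aeval_self_charpoly] using disjoint_ker_aeval_of_isCoprime A hco

section NearLinear

variable {E : Type*} [NormedAddCommGroup E] [NormedSpace ℝ E]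

/-- Comparison of the displacements along an orbit of a nearly linear map with the orbit of the
initial displacement under the linear part. -/
theorem norm_iterate_displacement_sub_le {f : E → E} {A : E →L[ℝ] E} {s : Set E} {ε : ℝ}
    (hε0 : 0 ≤ ε) (hε1 : ε ≤ 1)
    (hf : ∀ x ∈ s, ∀ y ∈ s, ‖f y - f x - A (y - x)‖ ≤ ε * ‖y - x‖) {z : E} {n : ℕ}
    (hz : ∀ i ≤ n, f^[i] z ∈ s) :
    ‖f^[n + 1] z - f^[n] z‖ ≤ (‖A‖ + 1) ^ n * ‖f z - z‖ ∧
      ‖f^[n + 1] z - f^[n] z - (A ^ n) (f z - z)‖ ≤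
        ε * (n * (‖A‖ + 1) ^ n) * ‖f z - z‖ := by
  induction n with
  | zero => simp
  | succ n ih =>
    obtain ⟨ih1, ih2⟩ := ih fun i hi => hz i (by omega)
    have hstep := hf _ (hz n (by omega)) _ (hz (n + 1) le_rfl)
    rw [← Function.iterate_succ_apply' f, ← Function.iterate_succ_apply' f] at hstep
    set v := f^[n + 1] z - f^[n] z
    set w := f^[n + 1 + 1] z - f^[n + 1] z
    set d := ‖f z - z‖
    have hA : 0 ≤ ‖A‖ := norm_nonneg A
    have hd : 0 ≤ d := norm_nonneg _
    constructor
    · calc ‖w‖ = ‖(w - A v) + A v‖ := by rw [sub_add_cancel]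
        _ ≤ ε * ‖v‖ + ‖A‖ * ‖v‖ := (norm_add_le _ _).trans (add_le_add hstep (A.le_opNorm v))
        _ ≤ (‖A‖ + 1) * ‖v‖ := by nlinarith [norm_nonneg v]
        _ ≤ (‖A‖ + 1) * ((‖A‖ + 1) ^ n * d) := by gcongr
        _ = (‖A‖ + 1) ^ (n + 1) * d := by ring
    · calc ‖w - (A ^ (n + 1)) (f z - z)‖
          = ‖(w - A v) + A (v - (A ^ n) (f z - z))‖ := by
            rw [map_sub A v, pow_succ', mul_apply_eq_comp, sub_add_sub_cancel]
        _ ≤ ε * ‖v‖ + ‖A‖ * ‖v - (A ^ n) (f z - z)‖ :=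
            (norm_add_le _ _).trans (add_le_add hstep (A.le_opNorm _))
        _ ≤ ε * ((‖A‖ + 1) ^ n * d) + ‖A‖ * (ε * (n * (‖A‖ + 1) ^ n) * d) := by gcongr
        _ ≤ ε * (((n + 1 : ℕ) : ℝ) * (‖A‖ + 1) ^ (n + 1)) * d := by
            have : 0 ≤ ε * (‖A‖ + 1) ^ n * d * (‖A‖ + n) := by positivity
            push_cast
            rw [pow_succ]
            linarith

/-- Iterates of a nearly linear map starting close enough to a fixed point stay close to it. -/
theorem iterate_mem_ball_of_nearly_linear {f : E → E} {A : E →L[ℝ] E} {p : E} {r ε : ℝ}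
    (hr : 0 < r) (hε1 : ε ≤ 1) (hp : f p = p)
    (hf : ∀ x ∈ Metric.ball p r, ∀ y ∈ Metric.ball p r,
      ‖f y - f x - A (y - x)‖ ≤ ε * ‖y - x‖) {k n : ℕ} (hn : n ≤ k) {z : E}
    (hz : z ∈ Metric.ball p (r / (‖A‖ + 1) ^ k)) :
    f^[n] z ∈ Metric.ball p r := by
  have hA : 0 ≤ ‖A‖ := norm_nonneg A
  have hzk : (‖A‖ + 1) ^ k * ‖z - p‖ < r := by
    rw [mem_ball_iff_norm, lt_div_iff₀ (by positivity)] at hz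
    linarith
  have of_le : ∀ i ≤ k, ‖f^[i] z - p‖ ≤ (‖A‖ + 1) ^ i * ‖z - p‖ → f^[i] z ∈ Metric.ball p r := by
    intro i hi h
    rw [mem_ball_iff_norm]
    refine (h.trans ?_).trans_lt hzk
    gcongr
    linarith
  suffices ∀ i ≤ k, ‖f^[i] z - p‖ ≤ (‖A‖ + 1) ^ i * ‖z - p‖ from of_le n hn (this n hn)
  intro i
  induction i with
  | zero => simp
  | succ i ih =>
    intro hi
    have hb := ih (by omega)
    have hstep := hf p (Metric.mem_ball_self hr) _ (of_le i (by omega) hb)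
    rw [← Function.iterate_succ_apply' f, hp] at hstep
    set x := f^[i] z
    calc ‖f^[i + 1] z - p‖ = ‖(f^[i + 1] z - p - A (x - p)) + A (x - p)‖ := by
          rw [sub_add_cancel]
      _ ≤ ε * ‖x - p‖ + ‖A‖ * ‖x - p‖ :=
          (norm_add_le _ _).trans (add_le_add hstep (A.le_opNorm _))
      _ ≤ (‖A‖ + 1) * ‖x - p‖ := by nlinarith [norm_nonneg (x - p)]
      _ ≤ (‖A‖ + 1) * ((‖A‖ + 1) ^ i * ‖z - p‖) := by gcongr
      _ = (‖A‖ + 1) ^ (i + 1) * ‖z - p‖ := by ring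

/-- If `1 + A + ⋯ + A ^ (k - 1)` is injective, then the `k`-periodic points near a fixed point of
any map sufficiently close to `A` are fixed points, uniformly in the map. -/
theorem exists_forall_periodic_near_fixed_of_nearly_linear [FiniteDimensional ℝ E]
    (A : E →L[ℝ] E) (k : ℕ)
    (hA : LinearMap.ker (∑ i ∈ Finset.range k, (A : E →ₗ[ℝ] E) ^ i) = ⊥) :
    ∃ ε > 0, ∀ (f : E → E) (p : E) (r : ℝ), 0 < r → f p = p →
      (∀ x ∈ Metric.ball p r, ∀ y ∈ Metric.ball p r,
        ‖f y - f x - A (y - x)‖ ≤ ε * ‖y - x‖) →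
      ∀ z ∈ Metric.ball p (r / (‖A‖ + 1) ^ k), f^[k] z = z → f z = z := by
  obtain ⟨K, hK, hanti⟩ := LinearMap.exists_antilipschitzWith _ hA
  set B : ℝ := ∑ i ∈ Finset.range k, i * (‖A‖ + 1) ^ i
  have hB : 0 ≤ B := Finset.sum_nonneg fun i _ => by positivity
  have hK' : (0 : ℝ) < K := hK
  refine ⟨1 / (K * B + 1), by positivity, fun f p r hr hp hf z hz hper => ?_⟩
  set ε : ℝ := 1 / (K * B + 1) with hε
  have hε0 : 0 < ε := by positivity
  have hε1 : ε ≤ 1 := by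
    rw [hε, div_le_one (by positivity)]
    linarith [mul_nonneg hK'.le hB]
  have hsum : ∑ i ∈ Finset.range k, (f^[i + 1] z - f^[i] z) = 0 := by
    rw [Finset.sum_range_sub (fun i => f^[i] z), hper]
    simp
  have hS : ‖∑ i ∈ Finset.range k, (A ^ i) (f z - z)‖ ≤ ε * B * ‖f z - z‖ := by
    rw [← norm_neg, ← zero_sub, ← hsum, ← Finset.sum_sub_distrib, Finset.mul_sum, Finset.sum_mul]
    refine norm_sum_le_of_le _ fun i hi => ?_
    exact (norm_iterate_displacement_sub_le hε0.le hε1 hf fun j hj =>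
      iterate_mem_ball_of_nearly_linear hr hε1 hp hf
        (hj.trans (Finset.mem_range.mp hi).le) hz).2
  have hle := hanti.le_mul_dist (f z - z) 0
  simp only [map_zero, dist_zero_right, LinearMap.sum_apply, ← ContinuousLinearMap.toLinearMap_pow,
    ContinuousLinearMap.coe_coe] at hle
  have hlt : K * (ε * B) < 1 := by
    rw [hε, show (K : ℝ) * (1 / (K * B + 1) * B) = K * B / (K * B + 1) by ring,
      div_lt_one (by positivity)]
    linarith
  have hv : ‖f z - z‖ ≤ K * (ε * B) * ‖f z - z‖ := by
    calc _ ≤ _ := hle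
      _ ≤ K * (ε * B * ‖f z - z‖) := by gcongr
      _ = _ := by ring
  have h0 : ‖f z - z‖ = 0 := by nlinarith [norm_nonneg (f z - z)]
  exact sub_eq_zero.mp (norm_eq_zero.mp h0)

end NearLinear


/-- Proposition 7.1: for a continuous family of C¹ diffeomorphisms of ℝ^m fixing `p`,
and an iteration `k` admissible at `p` for all members of the family, every
`k`-periodic point of `φ s` sufficiently close to `p` (uniformly in `s`) is a
fixed point of `φ s`. -/
theorem parametric_periodic_points_near_fixed_point_are_fixed
    (m k : ℕ) (hk : 1 ≤ k)
    (φ ψ : ℝ → EuclideanSpace ℝ (Fin m) → EuclideanSpace ℝ (Fin m))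
    (hφ : ∀ s ∈ Set.Icc (0:ℝ) 1, ContDiff ℝ 1 (φ s))
    (hψ : ∀ s ∈ Set.Icc (0:ℝ) 1, ContDiff ℝ 1 (ψ s))
    (hli : ∀ s ∈ Set.Icc (0:ℝ) 1, Function.LeftInverse (ψ s) (φ s))
    (hri : ∀ s ∈ Set.Icc (0:ℝ) 1, Function.RightInverse (ψ s) (φ s))
    (p : EuclideanSpace ℝ (Fin m))
    (hp : ∀ s ∈ Set.Icc (0:ℝ) 1, φ s p = p)
    (hcont : ContinuousOn (fun q : ℝ × EuclideanSpace ℝ (Fin m) => φ q.1 q.2)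
      (Set.Icc (0:ℝ) 1 ×ˢ Set.univ))
    (hcont' : ContinuousOn (fun q : ℝ × EuclideanSpace ℝ (Fin m) => fderiv ℝ (φ q.1) q.2)
      (Set.Icc (0:ℝ) 1 ×ˢ Set.univ))
    (hadm : ∀ s ∈ Set.Icc (0:ℝ) 1, ∀ μ : ℂ, μ ≠ 1 →
      (((fderiv ℝ (φ s) p : EuclideanSpace ℝ (Fin m) →ₗ[ℝ] EuclideanSpace ℝ (Fin m)).charpoly.map
        (algebraMap ℝ ℂ)).IsRoot μ) → μ ^ k ≠ 1) :
    ∃ U ∈ nhds p, ∀ s ∈ Set.Icc (0:ℝ) 1, ∀ z ∈ U, (φ s)^[k] z = z → φ s z = z := by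
  suffices h : ∀ s₀ ∈ Set.Icc (0 : ℝ) 1, ∀ᶠ q : EuclideanSpace ℝ (Fin m) × ℝ in nhds (p, s₀),
      q.2 ∈ Set.Icc (0 : ℝ) 1 → (φ q.2)^[k] q.1 = q.1 → φ q.2 q.1 = q.1 by
    have hU := isCompact_Icc.eventually_forall_of_forall_eventually
      (P := fun z s => s ∈ Set.Icc (0 : ℝ) 1 → (φ s)^[k] z = z → φ s z = z) h
    exact ⟨_, hU, fun s hs z hz => hz s hs hs⟩
  intro s₀ hs₀
  set A := fderiv ℝ (φ s₀) p
  obtain ⟨ε, hε, hfix⟩ := exists_forall_periodic_near_fixed_of_nearly_linear A k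
    (LinearMap.ker_geom_sum_eq_bot _ (by omega) (hadm s₀ hs₀))
  have hnear := (hcont' (s₀, p) ⟨hs₀, Set.mem_univ _⟩).eventually (Metric.ball_mem_nhds _ hε)
  obtain ⟨r, hr, hball⟩ := Metric.eventually_nhds_iff_ball.mp (eventually_nhdsWithin_iff.mp hnear)
  have hδ : 0 < r / (‖A‖ + 1) ^ k := by positivity
  filter_upwards [prod_mem_nhds (Metric.ball_mem_nhds p hδ) (Metric.ball_mem_nhds s₀ hr)]
  rintro ⟨z, s⟩ ⟨hz, hsr⟩ hs
  refine hfix (φ s) p r hr (hp s hs) (fun x hx y hy => ?_) z hz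
  refine (convex_ball p r).norm_image_sub_le_of_norm_fderiv_le'
    (fun u _ => ((hφ s hs).differentiable one_ne_zero).differentiableAt) (fun u hu => ?_) hx hy
  have := hball (s, u) (by rw [← ball_prod_same]; exact ⟨hsr, hu⟩) ⟨hs, Set.mem_univ _⟩
  exact (mem_ball_iff_norm.mp this).le
end

section
/- Let φ : [0,1] × ℝ^m → ℝ^m be such that each map φ_s := φ(s,·) is a C¹ diffeomorphism of ℝ^m, with (s,z) ↦ φ_s(z) and (s,z) ↦ D_z φ_s(z) jointly continuous, and assume p is a uniformly isolated fixed point of the family: there is a neighborhood V of p, independent of s, such that for every s ∈ [0,1] the only fixed point of φ_s in V is p. Let k ≥ 1 be admissible at p for every φ_s, i.e., for every s and every complex root λ ≠ 1 of the characteristic polynomial of D(φ_s)_p one has λ^k ≠ 1. Then p is a uniformly isolated fixed point of the family φ_s^k: there is a neighborhood W of p, independent of s, such that for every s the only fixed point of φ_s^k in W is p. -/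
open Filter Topology Asymptotics Polynomial

/-- If no complex root `μ ≠ 1` of `χ` is a `k`-th root of unity, then `χ` is coprime to
`1 + X + ⋯ + X ^ (k - 1)`. -/
theorem isCoprime_geom_sum_of_forall_root_pow_ne_one {χ : ℝ[X]} {k : ℕ} (hk : k ≠ 0)
    (h : ∀ μ : ℂ, μ ≠ 1 → (χ.map (algebraMap ℝ ℂ)).IsRoot μ → μ ^ k ≠ 1) :
    IsCoprime χ (∑ i ∈ Finset.range k, X ^ i) := by
  rw [Polynomial.isCoprime_iff_aeval_ne_zero_of_isAlgClosed ℝ ℂ]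
  intro μ
  by_contra! hμ
  obtain ⟨h₁, h₂⟩ := hμ
  simp only [map_sum, map_pow, aeval_X] at h₂
  by_cases hμ1 : μ = 1
  · simp [hμ1, hk] at h₂
  · refine h μ hμ1 ?_ ?_
    · rwa [IsRoot, eval_map_algebraMap]
    · have := geom_sum_mul μ k
      rw [h₂, zero_mul] at this
      exact sub_eq_zero.mp this.symm

section

variable {E : Type*} [NormedAddCommGroup E] [NormedSpace ℝ E]

/-- Under the root condition on the characteristic polynomial, `1 + A + ⋯ + A ^ (k - 1)` has a
left inverse. -/
theorem exists_leftInverse_geom_sum [FiniteDimensional ℝ E] (A : E →L[ℝ] E) {k : ℕ} (hk : k ≠ 0)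
    (h : ∀ μ : ℂ, μ ≠ 1 →
      ((A : E →ₗ[ℝ] E).charpoly.map (algebraMap ℝ ℂ)).IsRoot μ → μ ^ k ≠ 1) :
    ∃ B : E →L[ℝ] E, ∀ v, B (∑ i ∈ Finset.range k, (A ^ i) v) = v := by
  obtain ⟨a, b, hab⟩ := isCoprime_geom_sum_of_forall_root_pow_ne_one hk h
  refine ⟨LinearMap.toContinuousLinearMap (aeval (A : E →ₗ[ℝ] E) b), fun v => ?_⟩
  have := congrArg (fun q : ℝ[X] => aeval (A : E →ₗ[ℝ] E) q v) hab
  simpa [LinearMap.aeval_self_charpoly, Module.End.pow_apply] using this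

/-- A family of maps whose derivative is jointly continuous at `(s₀, p)` is strictly
differentiable at `p`, uniformly in the parameter near `s₀`. -/
theorem isLittleO_sub_sub_of_tendsto_fderiv {S : Type*} {l : Filter S} {f : S → E → E} {p : E}
    {A : E →L[ℝ] E} (hf : ∀ᶠ s in l, Differentiable ℝ (f s))
    (hA : Tendsto (fun q : S × E => fderiv ℝ (f q.1) q.2) (l ×ˢ 𝓝 p) (𝓝 A)) :
    (fun q : S × E × E => f q.1 q.2.1 - f q.1 q.2.2 - A (q.2.1 - q.2.2))
      =o[l ×ˢ 𝓝 (p, p)] fun q => q.2.1 - q.2.2 := by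
  rw [isLittleO_iff]
  intro ε hε
  have h₁ : ∀ᶠ q : S × E in l ×ˢ 𝓝 p, ‖fderiv ℝ (f q.1) q.2 - A‖ ≤ ε := by
    filter_upwards [hA (Metric.closedBall_mem_nhds A hε)] with q hq
    simpa [dist_eq_norm] using hq
  obtain ⟨P, hP, Q, hQ, hPQ⟩ := eventually_prod_iff.mp h₁
  obtain ⟨r, hr, hrQ⟩ := Metric.eventually_nhds_iff_ball.mp hQ
  have hball := Metric.ball_mem_nhds p hr
  filter_upwards [(hP.and hf).prod_mk (prod_mem_nhds hball hball)] with ⟨s, x, y⟩ ⟨⟨hs, hd⟩, hx, hy⟩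
  exact (convex_ball p r).norm_image_sub_le_of_norm_hasFDerivWithin_le'
    (fun z _ => (hd z).hasFDerivAt.hasFDerivWithinAt) (fun z hz => hPQ hs (hrQ z hz)) hy hx

theorem tendsto_iterate_prod {S X : Type*} [TopologicalSpace X] {l : Filter S} {f : S → X → X}
    {p : X} (hf : Tendsto (fun q : S × X => f q.1 q.2) (l ×ˢ 𝓝 p) (𝓝 p)) (i : ℕ) :
    Tendsto (fun q : S × X => (f q.1)^[i] q.2) (l ×ˢ 𝓝 p) (𝓝 p) := by
  induction i with
  | zero => exact tendsto_snd
  | succ i ih =>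
    simp only [Function.iterate_succ_apply']
    exact hf.comp (tendsto_fst.prodMk ih)

/-- Increments along an orbit are, to first order, given by the powers of the derivative. -/
theorem isLittleO_iterate_increment {S : Type*} {l : Filter S} {f : S → E → E} {p : E}
    {A : E →L[ℝ] E} (hf : ∀ᶠ s in l, Differentiable ℝ (f s))
    (hc : Tendsto (fun q : S × E => f q.1 q.2) (l ×ˢ 𝓝 p) (𝓝 p))
    (hA : Tendsto (fun q : S × E => fderiv ℝ (f q.1) q.2) (l ×ˢ 𝓝 p) (𝓝 A)) (i : ℕ) :
    (fun q : S × E => (f q.1)^[i + 1] q.2 - (f q.1)^[i] q.2 - (A ^ i) (f q.1 q.2 - q.2))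
      =o[l ×ˢ 𝓝 p] fun q => f q.1 q.2 - q.2 := by
  induction i with
  | zero => simp
  | succ i ih =>
    have hO : (fun q : S × E => (f q.1)^[i + 1] q.2 - (f q.1)^[i] q.2)
        =O[l ×ˢ 𝓝 p] fun q => f q.1 q.2 - q.2 := by
      simpa using ih.isBigO.add ((A ^ i).isBigO_comp (fun q : S × E => f q.1 q.2 - q.2) _)
    have ht := tendsto_fst.prodMk
      ((tendsto_iterate_prod hc (i + 1)).prodMk_nhds (tendsto_iterate_prod hc i))
    have h₁ := ((isLittleO_sub_sub_of_tendsto_fderiv hf hA).comp_tendsto ht).trans_isBigO hO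
    have h₂ := (A.isBigO_comp _ _).trans_isLittleO ih
    refine (h₁.add h₂).congr_left fun q => ?_
    simp only [Function.comp_apply, Function.iterate_succ_apply', pow_succ', map_sub,
      mul_apply_eq_comp]
    abel

/-- If `1 + A + ⋯ + A ^ (k - 1)` has a left inverse, then near `p` every fixed point of the `k`-th
iterate is a fixed point of the map itself. -/
theorem eventually_isFixedPt_of_iterate {S : Type*} {l : Filter S} {f : S → E → E} {p : E}
    {A : E →L[ℝ] E} (hf : ∀ᶠ s in l, Differentiable ℝ (f s))
    (hc : Tendsto (fun q : S × E => f q.1 q.2) (l ×ˢ 𝓝 p) (𝓝 p))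
    (hA : Tendsto (fun q : S × E => fderiv ℝ (f q.1) q.2) (l ×ˢ 𝓝 p) (𝓝 A)) {k : ℕ}
    {B : E →L[ℝ] E} (hB : ∀ v, B (∑ i ∈ Finset.range k, (A ^ i) v) = v) :
    ∀ᶠ q : S × E in l ×ˢ 𝓝 p, (f q.1)^[k] q.2 = q.2 → f q.1 q.2 = q.2 := by
  have h₁ := IsLittleO.sum (s := Finset.range k)
    fun i _ => isLittleO_iterate_increment hf hc hA i
  have h₂ := (B.isBigO_comp _ _).trans_isLittleO h₁
  filter_upwards [isLittleO_iff.mp h₂ (half_pos one_pos)] with q hq hfix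
  rw [Finset.sum_apply, Finset.sum_sub_distrib, Finset.sum_range_sub (fun i => (f q.1)^[i] q.2), hfix] at hq
  simp only [Function.iterate_zero, id, sub_self, zero_sub, map_neg, hB, norm_neg] at hq
  exact sub_eq_zero.mp (norm_eq_zero.mp (by linarith [norm_nonneg (f q.1 q.2 - q.2)]))

end


/-- Remark 1.4 (parametric version of Proposition 1.3): a uniformly isolated fixed
point of a continuous family of C¹ diffeomorphisms of ℝ^m remains uniformly
isolated under any iteration admissible for all members of the family. -/
theorem uniformly_isolated_fixed_point_persists_under_admissible_iteration
    (m k : ℕ) (hk : 1 ≤ k)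
    (φ ψ : ℝ → EuclideanSpace ℝ (Fin m) → EuclideanSpace ℝ (Fin m))
    (hφ : ∀ s ∈ Set.Icc (0:ℝ) 1, ContDiff ℝ 1 (φ s))
    (hψ : ∀ s ∈ Set.Icc (0:ℝ) 1, ContDiff ℝ 1 (ψ s))
    (hli : ∀ s ∈ Set.Icc (0:ℝ) 1, Function.LeftInverse (ψ s) (φ s))
    (hri : ∀ s ∈ Set.Icc (0:ℝ) 1, Function.RightInverse (ψ s) (φ s))
    (p : EuclideanSpace ℝ (Fin m))
    (hcont : ContinuousOn (fun q : ℝ × EuclideanSpace ℝ (Fin m) => φ q.1 q.2)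
      (Set.Icc (0:ℝ) 1 ×ˢ Set.univ))
    (hcont' : ContinuousOn (fun q : ℝ × EuclideanSpace ℝ (Fin m) => fderiv ℝ (φ q.1) q.2)
      (Set.Icc (0:ℝ) 1 ×ˢ Set.univ))
    (hiso : ∃ V ∈ nhds p, ∀ s ∈ Set.Icc (0:ℝ) 1, ∀ z ∈ V, φ s z = z → z = p)
    (hp : ∀ s ∈ Set.Icc (0:ℝ) 1, φ s p = p)
    (hadm : ∀ s ∈ Set.Icc (0:ℝ) 1, ∀ μ : ℂ, μ ≠ 1 →
      (((fderiv ℝ (φ s) p : EuclideanSpace ℝ (Fin m) →ₗ[ℝ] EuclideanSpace ℝ (Fin m)).charpoly.map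
        (algebraMap ℝ ℂ)).IsRoot μ) → μ ^ k ≠ 1) :
    ∃ W ∈ nhds p, ∀ s ∈ Set.Icc (0:ℝ) 1, ∀ z ∈ W, (φ s)^[k] z = z → z = p := by
  obtain ⟨V, hV, hVp⟩ := hiso
  have key : ∀ s₀ ∈ Set.Icc (0:ℝ) 1, ∀ᶠ q : ℝ × EuclideanSpace ℝ (Fin m) in 𝓝 (s₀, p),
      q.1 ∈ Set.Icc (0:ℝ) 1 → (φ q.1)^[k] q.2 = q.2 → q.2 = p := by
    intro s₀ hs₀
    have hl : 𝓝[Set.Icc (0:ℝ) 1 ×ˢ Set.univ] (s₀, p) = 𝓝[Set.Icc (0:ℝ) 1] s₀ ×ˢ 𝓝 p := by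
      rw [nhdsWithin_prod_eq, nhdsWithin_univ]
    have hmem : (s₀, p) ∈ Set.Icc (0:ℝ) 1 ×ˢ (Set.univ : Set (EuclideanSpace ℝ (Fin m))) :=
      ⟨hs₀, trivial⟩
    have hc := hcont _ hmem
    have hA := hcont' _ hmem
    rw [ContinuousWithinAt, hl] at hc hA
    simp only [hp s₀ hs₀] at hc
    obtain ⟨B, hB⟩ := exists_leftInverse_geom_sum _ (Nat.one_le_iff_ne_zero.mp hk) (hadm s₀ hs₀)
    have hd : ∀ᶠ s in 𝓝[Set.Icc (0:ℝ) 1] s₀, Differentiable ℝ (φ s) := by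
      filter_upwards [self_mem_nhdsWithin] with s hs
      exact (hφ s hs).differentiable one_ne_zero
    have h := eventually_isFixedPt_of_iterate hd hc hA hB
    rw [← hl, eventually_nhdsWithin_iff] at h
    filter_upwards [h, continuous_snd.continuousAt.preimage_mem_nhds hV] with q hq hqV hs hfix
    exact hVp q.1 hs q.2 hqV (hq ⟨hs, trivial⟩ hfix)
  have hW : ∀ᶠ z in 𝓝 p, ∀ s ∈ Set.Icc (0:ℝ) 1,
      s ∈ Set.Icc (0:ℝ) 1 → (φ s)^[k] z = z → z = p :=
    isCompact_Icc.eventually_forall_of_forall_eventually fun s hs =>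
      (continuous_swap.tendsto (p, s)).eventually (key s hs)
  exact ⟨_, hW, fun s hs z hz => hz s hs hs⟩
end

section
/- Let k ≥ 1 and m ≥ 0, and let c > 0 be a constant such that Σ_l ‖ξ_l‖ ≤ c · Σ_l ‖ξ_{l+1} − ξ_l‖ for every ξ : ℤ/kℤ → ℝ^m with ξ_1 + ⋯ + ξ_k = 0. Let f : ℝ^m → ℝ^m be Lipschitz with Lipschitz constant L satisfying L·c < 1. Then every k-periodic orbit of φ = id + f is constant: if z : ℤ/kℤ → ℝ^m satisfies z_{l+1} = z_l + f(z_l) for all l ∈ ℤ/kℤ, then z_l is the same point for all l, and this point is a fixed point of φ. -/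
/-- The discrete Yorke-type estimate (Example 7.2): if `c` is a discrete Poincaré
constant for zero-mean maps `ℤ/kℤ → ℝ^m` and `f` is Lipschitz with constant `L`
satisfying `L·c < 1`, then every `k`-periodic orbit of `φ = id + f` is a constant
orbit at a fixed point of `φ`. -/
theorem periodic_orbits_of_small_lipschitz_perturbation_are_fixed
    (k m : ℕ) [NeZero k] (c : ℝ) (hc : 0 < c)
    (hpoincare : ∀ ξ : ZMod k → EuclideanSpace ℝ (Fin m),
      (∑ l : ZMod k, ξ l) = 0 →
      ∑ l : ZMod k, ‖ξ l‖ ≤ c * ∑ l : ZMod k, ‖ξ (l + 1) - ξ l‖)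
    (f : EuclideanSpace ℝ (Fin m) → EuclideanSpace ℝ (Fin m)) (L : ℝ)
    (hf : ∀ x y, ‖f x - f y‖ ≤ L * ‖x - y‖)
    (hLc : L * c < 1)
    (z : ZMod k → EuclideanSpace ℝ (Fin m))
    (hz : ∀ l : ZMod k, z (l + 1) = z l + f (z l)) :
    (∀ l : ZMod k, z l = z 0) ∧ z 0 + f (z 0) = z 0 := by
  have hstep : ∀ l, z (l + 1) - z l = f (z l) := fun l => by rw [hz l, add_sub_cancel_left]
  have hsum : ∑ l : ZMod k, f (z l) = 0 := by
    simp_rw [← hstep, Finset.sum_sub_distrib]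
    rw [sub_eq_zero]
    exact Equiv.sum_comp (Equiv.addRight (1 : ZMod k)) z
  have hlip : ∑ l : ZMod k, ‖f (z (l + 1)) - f (z l)‖ ≤ L * ∑ l : ZMod k, ‖f (z l)‖ := by
    rw [Finset.mul_sum]
    refine Finset.sum_le_sum fun l _ => ?_
    simpa only [hstep] using hf (z (l + 1)) (z l)
  have hnonneg : 0 ≤ ∑ l : ZMod k, ‖f (z l)‖ := Finset.sum_nonneg fun l _ => norm_nonneg _
  have hnorm : ∑ l : ZMod k, ‖f (z l)‖ = 0 := by
    have h := (hpoincare (fun l => f (z l)) hsum).trans (mul_le_mul_of_nonneg_left hlip hc.le)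
    nlinarith
  have hzero : ∀ l, f (z l) = 0 := fun l =>
    norm_eq_zero.mp
      ((Finset.sum_eq_zero_iff_of_nonneg fun l _ => norm_nonneg (f (z l))).mp hnorm l
        (Finset.mem_univ l))
  have hconst : ∀ n : ℕ, z (n : ZMod k) = z 0 := by
    intro n
    induction n with
    | zero => rw [Nat.cast_zero]
    | succ n ih => rw [Nat.cast_succ, hz, hzero, add_zero, ih]
  refine ⟨fun l => ?_, by rw [hzero, add_zero]⟩
  rw [← ZMod.natCast_zmod_val l, hconst]
end

section
/- Let U ⊆ ℝ^m be open, let φ : U → ℝ^m be C¹ with φ(p) = p for some p ∈ U, and assume the derivative of φ at p is the identity: Dφ_p = id. Then for every integer k ≥ 1 there exists a neighborhood V ⊆ U of p such that: if z ∈ V satisfies φ^l(z) ∈ V for all 0 ≤ l ≤ k and φ^k(z) = z, then φ(z) = z. -/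
open Function in
/-- If `φ` is `c`-close to the identity (up to translation) on a set containing the first iterates
of `z`, then these iterates nearly form an arithmetic progression. -/
theorem ApproximatesLinearOn.norm_iterate_sub_le {E : Type*} [NormedAddCommGroup E]
    [NormedSpace ℝ E] {φ : E → E} {V : Set E} {c : NNReal} (hc : c ≤ 1)
    (hφ : ApproximatesLinearOn φ (ContinuousLinearMap.id ℝ E) V c) {z : E} :
    ∀ l : ℕ, (∀ j ≤ l, φ^[j] z ∈ V) →
      ‖φ^[l] z - z‖ ≤ (2 ^ l - 1) * ‖φ z - z‖ ∧
        ‖φ^[l] z - z - (l : ℝ) • (φ z - z)‖ ≤ c * 2 ^ l * ‖φ z - z‖ := by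
  intro l
  induction l with
  | zero =>
    intro _
    simp only [iterate_zero, id_eq, sub_self, norm_zero, pow_zero, zero_mul, le_refl,
      Nat.cast_zero, zero_smul, mul_one, true_and]
    positivity
  | succ l ih =>
    intro hV
    obtain ⟨hdist, herr⟩ := ih fun j hj => hV j (hj.trans l.le_succ)
    have hstep : ‖φ (φ^[l] z) - φ z - (φ^[l] z - z)‖ ≤ c * ‖φ^[l] z - z‖ :=
      hφ _ (hV l l.le_succ) _ (hV 0 (Nat.zero_le _))
    have hc1 : (c : ℝ) ≤ 1 := hc
    have hc0 : (0 : ℝ) ≤ c := c.2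
    have hd : 0 ≤ ‖φ z - z‖ := norm_nonneg _
    have hcd : c * ‖φ^[l] z - z‖ ≤ c * ((2 ^ l - 1) * ‖φ z - z‖) := by gcongr
    have hc' : c * ‖φ^[l] z - z‖ ≤ ‖φ^[l] z - z‖ :=
      mul_le_of_le_one_left (norm_nonneg _) hc1
    have hprod : 0 ≤ c * ‖φ z - z‖ := mul_nonneg hc0 hd
    rw [iterate_succ_apply', pow_succ]
    constructor
    · calc ‖φ (φ^[l] z) - z‖
          = ‖(φ (φ^[l] z) - φ z - (φ^[l] z - z)) + (φ^[l] z - z) + (φ z - z)‖ := by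
            congr 1; abel
        _ ≤ ‖φ (φ^[l] z) - φ z - (φ^[l] z - z)‖ + ‖φ^[l] z - z‖ + ‖φ z - z‖ := norm_add₃_le
        _ ≤ _ := by linarith
    · calc ‖φ (φ^[l] z) - z - ((l + 1 : ℕ) : ℝ) • (φ z - z)‖
          = ‖(φ (φ^[l] z) - φ z - (φ^[l] z - z)) +
              (φ^[l] z - z - (l : ℝ) • (φ z - z))‖ := by
            congr 1; push_cast; module
        _ ≤ ‖φ (φ^[l] z) - φ z - (φ^[l] z - z)‖ +
              ‖φ^[l] z - z - (l : ℝ) • (φ z - z)‖ := norm_add_le _ _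
        _ ≤ _ := by linarith


/-- Example 7.2: if a C¹ map has a fixed point `p` with identity linearization,
then for each `k ≥ 1` every `k`-periodic orbit sufficiently close to `p`
consists of fixed points. -/
theorem periodic_points_near_fixed_point_with_identity_linearization_are_fixed
    (m : ℕ) (U : Set (EuclideanSpace ℝ (Fin m))) (hU : IsOpen U)
    (φ : EuclideanSpace ℝ (Fin m) → EuclideanSpace ℝ (Fin m))
    (hφ : ContDiffOn ℝ 1 φ U)
    (p : EuclideanSpace ℝ (Fin m)) (hpU : p ∈ U) (hp : φ p = p)
    (hD : fderiv ℝ φ p = ContinuousLinearMap.id ℝ (EuclideanSpace ℝ (Fin m)))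
    (k : ℕ) (hk : 1 ≤ k) :
    ∃ V ∈ nhds p, V ⊆ U ∧
      ∀ z ∈ V, (∀ l ≤ k, φ^[l] z ∈ V) → φ^[k] z = z → φ z = z := by
  have hstrict : HasStrictFDerivAt φ (ContinuousLinearMap.id ℝ (EuclideanSpace ℝ (Fin m))) p :=
    hD ▸ (hφ.contDiffAt (hU.mem_nhds hpU)).hasStrictFDerivAt one_ne_zero
  obtain ⟨s, hs, happrox⟩ := hstrict.approximates_deriv_on_nhds
    (c := (2 ^ (k + 1))⁻¹) (Or.inr (by positivity))
  refine ⟨s ∩ U, Filter.inter_mem hs (hU.mem_nhds hpU), Set.inter_subset_right, ?_⟩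
  intro z _ horbit hper
  have herr := (happrox.norm_iterate_sub_le
    (inv_le_one_of_one_le₀ (one_le_pow₀ one_le_two)) k fun j hj => (horbit j hj).1).2
  have hcoef : (((2 ^ (k + 1))⁻¹ : NNReal) : ℝ) * 2 ^ k = 1 / 2 := by
    push_cast
    field_simp
    ring
  rw [hper, sub_self, zero_sub, norm_neg, norm_smul, hcoef, Real.norm_natCast] at herr
  have hk' : (1 : ℝ) ≤ k := by exact_mod_cast hk
  have hd : ‖φ z - z‖ ≤ 0 := by nlinarith [norm_nonneg (φ z - z)]
  exact sub_eq_zero.mp (norm_le_zero_iff.mp hd)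
end

section
/- Let g : ℝ^m → ℝ^m be Lipschitz with constant L > 0 and set φ = id + g. Then for every integer k ≥ 1 and every z ∈ ℝ^m, ‖φ^k(z) − z − k·g(z)‖ ≤ (((1+L)^k − 1 − kL)/L) · ‖g(z)‖; in particular, ‖φ^k(z) − z − k·(φ(z) − z)‖ ≤ (((1+L)^k − 1 − kL)/L) · ‖φ(z) − z‖. -/
/-- In a real seminormed space, the displacement of the `k`-th iterate of `φ = id + g`, with `g`
Lipschitz with constant `L`, is close to `k` times the displacement of `φ`. -/
theorem norm_iterate_sub_sub_smul_le {E : Type*} [SeminormedAddCommGroup E] [NormedSpace ℝ E]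
    {g φ : E → E} {L : ℝ} (hL : 0 < L) (hg : ∀ x y, ‖g x - g y‖ ≤ L * ‖x - y‖)
    (hφ : ∀ z, φ z = z + g z) (k : ℕ) (z : E) :
    ‖φ^[k] z - z - (k : ℝ) • g z‖ ≤ (((1 + L) ^ k - 1 - k * L) / L) * ‖g z‖ := by
  induction k with
  | zero => simp
  | succ n ih =>
    set w := φ^[n] z with hw
    have split : φ^[n + 1] z - z - ((n + 1 : ℕ) : ℝ) • g z =
        (w - z - (n : ℝ) • g z) + (g w - g z) := by
      rw [Function.iterate_succ_apply', ← hw, hφ w]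
      push_cast
      module
    have displacement : ‖w - z‖ ≤ ‖w - z - (n : ℝ) • g z‖ + n * ‖g z‖ := by
      calc ‖w - z‖ = ‖(w - z - (n : ℝ) • g z) + (n : ℝ) • g z‖ := by rw [sub_add_cancel]
        _ ≤ ‖w - z - (n : ℝ) • g z‖ + ‖(n : ℝ) • g z‖ := norm_add_le _ _
        _ = ‖w - z - (n : ℝ) • g z‖ + n * ‖g z‖ := by
          rw [norm_smul, Real.norm_natCast]
    calc ‖φ^[n + 1] z - z - ((n + 1 : ℕ) : ℝ) • g z‖
        ≤ ‖w - z - (n : ℝ) • g z‖ + ‖g w - g z‖ := split ▸ norm_add_le _ _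
      _ ≤ ‖w - z - (n : ℝ) • g z‖ + L * (‖w - z - (n : ℝ) • g z‖ + n * ‖g z‖) := by
        gcongr
        exact (hg w z).trans (by gcongr)
      _ = (1 + L) * ‖w - z - (n : ℝ) • g z‖ + L * n * ‖g z‖ := by ring
      _ ≤ (1 + L) * ((((1 + L) ^ n - 1 - n * L) / L) * ‖g z‖) + L * n * ‖g z‖ := by gcongr
      _ = (((1 + L) ^ (n + 1) - 1 - (n + 1 : ℕ) * L) / L) * ‖g z‖ := by
        push_cast
        field_simp
        ring

/-- Inequality (4.1): for `φ = id + g` with `g` Lipschitz with constant `L`, the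
`k`-th iterate satisfies `‖φ^k(z) − z − k·g(z)‖ ≤ (((1+L)^k − 1 − kL)/L)·‖g(z)‖`. -/
theorem iterate_displacement_close_to_k_times_displacement
    (m : ℕ) (g : EuclideanSpace ℝ (Fin m) → EuclideanSpace ℝ (Fin m))
    (L : ℝ) (hL : 0 < L)
    (hg : ∀ x y, ‖g x - g y‖ ≤ L * ‖x - y‖)
    (φ : EuclideanSpace ℝ (Fin m) → EuclideanSpace ℝ (Fin m))
    (hφ : ∀ z, φ z = z + g z)
    (k : ℕ) (hk : 1 ≤ k) (z : EuclideanSpace ℝ (Fin m)) :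
    ‖φ^[k] z - z - (k : ℝ) • g z‖ ≤ (((1 + L) ^ k - 1 - k * L) / L) * ‖g z‖ ∧
    ‖φ^[k] z - z - (k : ℝ) • (φ z - z)‖ ≤ (((1 + L) ^ k - 1 - k * L) / L) * ‖φ z - z‖ := by
  have displacement : φ z - z = g z := by rw [hφ, add_sub_cancel_left]
  rw [displacement]
  have bound := norm_iterate_sub_sub_smul_le hL hg hφ k z
  exact ⟨bound, bound⟩
end
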